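/- arXiv:2405.02872 — 2 statements merged into one kernel-verified Lean document; each statement's English description precedes it below -/
import Mathlib

section
/- There exists a constant C > 0 with the following property: for every real Hilbert space H, every bounded selfadjoint coercive operator A on H, every τ > 0, every N ≥ 7, every choice of f⁶,…,f^N ∈ H and starting values u⁰,…,u⁶ ∈ H, the WSBDF7 approximations satisfy ‖uⁿ‖² + τ|∂_τ uⁿ|² ≤ C Σ_{j=0}^{6} ‖u^j‖² + C τ Σ_{j=1}^{6} |∂_τ u^j|² + C τ Σ_{ℓ=6}^{n} |f^ℓ|² for all n = 7,…,N, where ∂_τ uⁿ := (uⁿ − u^{n−1})/τ. (Third stability estimate for the WSBDF7 method with weight θ = 3.) -/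
open scoped RealInnerProductSpace

/-- Coefficients `α₀,…,α₇` of the WSBDF7 characteristic polynomial
`α(ζ) = (1/420)(3147ζ⁷ − 10038ζ⁶ + 15750ζ⁵ − 16800ζ⁴ + 12425ζ³ − 5922ζ² + 1638ζ − 200)`. -/
noncomputable def alphaCoeff : Fin 8 → ℝ :=
  ![-200 / 420, 1638 / 420, -5922 / 420, 12425 / 420,
    -16800 / 420, 15750 / 420, -10038 / 420, 3147 / 420]

/-- The form measuring the difference quotients in the energy of the WSBDF7 scheme. -/
noncomputable def differenceEnergy {H : Type*} [AddCommGroup H] [Module ℝ H]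
    (b : LinearMap.BilinForm ℝ H)
    (x1 x2 x3 x4 x5 x6 : H) : ℝ :=
  letI q : H → ℝ := fun x => b x x
  121 * q (x1 - (741/200 : ℝ) • x2 + (257/25 : ℝ) • x3 - (2881/200 : ℝ) • x4 + (2079/200 : ℝ) • x5
      - (18/5 : ℝ) • x6)
    + 1539 * q (x2 - (11/4 : ℝ) • x3 + (417/100 : ℝ) • x4 - (339/100 : ℝ) • x5 + (67/50 : ℝ) • x6)
    + 2117 * q (x3 - (227/100 : ℝ) • x4 + (117/40 : ℝ) • x5 - (329/200 : ℝ) • x6)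
    + 2838 * q (x4 - (33/20 : ℝ) • x5 + (217/200 : ℝ) • x6)
    + 1965 * q (x5 - (19/20 : ℝ) • x6)
    + 1141 * q x6

/-- The form measuring the newest value `w` and the last three differences in the energy of the
WSBDF7 scheme. -/
noncomputable def stateEnergy {H : Type*} [AddCommGroup H] [Module ℝ H]
    (b : LinearMap.BilinForm ℝ H)
    (w x2 x3 x4 : H) : ℝ :=
  letI q : H → ℝ := fun x => b x x
  3/2 * q (w + x2 - (5/3 : ℝ) • x3 + (7/3 : ℝ) • x4)
    + 3/2 * q (x2 - (13/10 : ℝ) • x3 + (1/20 : ℝ) • x4)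
    + 16/5 * q (x3 - (5/4 : ℝ) • x4)
    + 6/5 * q x4

section Forms

variable {H : Type*} [AddCommGroup H] [Module ℝ H] {b : LinearMap.BilinForm ℝ H}

lemma differenceEnergy_dissipation (hs : ∀ x y, b x y = b y x) (hn : ∀ x, 0 ≤ b x x)
    (x0 x1 x2 x3 x4 x5 x6 : H) :
    differenceEnergy b x1 x2 x3 x4 x5 x6 - differenceEnergy b x0 x1 x2 x3 x4 x5
      + 1 / 10 * b ((10 : ℝ) • x6 - (12 : ℝ) • x5 + (8 : ℝ) • x4 - (3 : ℝ) • x3)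
        ((10 : ℝ) • x6 - (12 : ℝ) • x5 + (8 : ℝ) • x4 - (3 : ℝ) • x3)
    ≤ b ((3147 : ℝ) • x6 - (6891 : ℝ) • x5 + (8859 : ℝ) • x4 - (7941 : ℝ) • x3 + (4484 : ℝ) • x2
        - (1438 : ℝ) • x1 + (200 : ℝ) • x0)
        ((10 : ℝ) • x6 - (12 : ℝ) • x5 + (8 : ℝ) • x4 - (3 : ℝ) • x3) := by
  have h0 := hn (x0 - (197/40 : ℝ) • x1 + (1367/100 : ℝ) • x2 - (449/20 : ℝ) • x3
      + (4523/200 : ℝ) • x4 - (719/40 : ℝ) • x5 + (1099/100 : ℝ) • x6)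
  have h1 := hn (x1 - (539/200 : ℝ) • x2 + (443/100 : ℝ) • x3 - (223/50 : ℝ) • x4
      + (711/200 : ℝ) • x5 - (87/40 : ℝ) • x6)
  have h2 := hn (x2 - (143/100 : ℝ) • x3 + (289/200 : ℝ) • x4 - (119/100 : ℝ) • x5
      + (143/200 : ℝ) • x6)
  have h3 := hn (x3 - (141/200 : ℝ) • x4 + (69/100 : ℝ) • x5 - (37/100 : ℝ) • x6)
  have h4 := hn (x4 - (5/8 : ℝ) • x5 + (49/200 : ℝ) • x6)
  have h5 := hn (x5 + (79/200 : ℝ) • x6)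
  have h6 := hn x6
  have h7 := hn (x0 - x1)
  have h8 := hn (x0 - x2)
  have h9 := hn (x1 - x2)
  have h10 := hn (x0 - x3)
  have h11 := hn (x1 + x3)
  have h12 := hn (x2 - x3)
  have h13 := hn (x0 - x4)
  have h14 := hn (x1 - x4)
  have h15 := hn (x2 + x4)
  have h16 := hn (x3 - x4)
  have h17 := hn (x0 + x5)
  have h18 := hn (x1 + x5)
  have h19 := hn (x2 - x5)
  have h20 := hn (x3 + x5)
  have h21 := hn (x4 - x5)
  have h22 := hn (x0 - x6)
  have h23 := hn (x1 - x6)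
  have h24 := hn (x2 + x6)
  have h25 := hn (x3 - x6)
  have h26 := hn (x4 + x6)
  have h27 := hn (x5 - x6)
  have h28 := hn x0
  have h29 := hn x1
  have h30 := hn x2
  have h31 := hn x3
  have h32 := hn x4
  have h33 := hn x5
  simp only [differenceEnergy, map_add, map_sub, map_smul, LinearMap.add_apply, LinearMap.sub_apply,
    LinearMap.smul_apply, smul_eq_mul, hs x1 x0, hs x2 x0, hs x2 x1, hs x3 x0, hs x3 x1, hs x3 x2,
    hs x4 x0, hs x4 x1, hs x4 x2, hs x4 x3, hs x5 x0, hs x5 x1, hs x5 x2, hs x5 x3, hs x5 x4,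
    hs x6 x0, hs x6 x1, hs x6 x2, hs x6 x3, hs x6 x4, hs x6 x5]
    at h0 h1 h2 h3 h4 h5 h6 h7 h8 h9 h10 h11 h12 h13 h14 h15 h16 h17 h18 h19 h20 h21 h22 h23 h24
        h25 h26 h27 h28 h29 h30 h31 h32 h33 ⊢
  linarith

lemma differenceEnergy_le (hs : ∀ x y, b x y = b y x) (hn : ∀ x, 0 ≤ b x x)
    (x1 x2 x3 x4 x5 x6 : H) :
    differenceEnergy b x1 x2 x3 x4 x5 x6
      ≤ 1000000 * (b x1 x1 + b x2 x2 + b x3 x3 + b x4 x4 + b x5 x5 + b x6 x6) := by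
  have h0 := hn (x1 + x2)
  have h1 := hn (x1 - x3)
  have h2 := hn (x2 + x3)
  have h3 := hn (x1 + x4)
  have h4 := hn (x2 - x4)
  have h5 := hn (x3 + x4)
  have h6 := hn (x1 - x5)
  have h7 := hn (x2 + x5)
  have h8 := hn (x3 - x5)
  have h9 := hn (x4 + x5)
  have h10 := hn (x1 + x6)
  have h11 := hn (x2 - x6)
  have h12 := hn (x3 + x6)
  have h13 := hn (x4 - x6)
  have h14 := hn (x5 + x6)
  have h15 := hn x1
  have h16 := hn x2
  have h17 := hn x3
  have h18 := hn x4
  have h19 := hn x5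
  have h20 := hn x6
  simp only [differenceEnergy, map_add, map_sub, map_smul, LinearMap.add_apply, LinearMap.sub_apply,
    LinearMap.smul_apply, smul_eq_mul, hs x2 x1, hs x3 x1, hs x3 x2, hs x4 x1, hs x4 x2, hs x4 x3,
    hs x5 x1, hs x5 x2, hs x5 x3, hs x5 x4, hs x6 x1, hs x6 x2, hs x6 x3, hs x6 x4, hs x6 x5]
    at h0 h1 h2 h3 h4 h5 h6 h7 h8 h9 h10 h11 h12 h13 h14 h15 h16 h17 h18 h19 h20 ⊢
  linarith

lemma le_differenceEnergy (hn : ∀ x, 0 ≤ b x x) (x1 x2 x3 x4 x5 x6 : H) :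
    1141 * b x6 x6 ≤ differenceEnergy b x1 x2 x3 x4 x5 x6 := by
  simp only [differenceEnergy]
  linarith [hn (x1 - (741/200 : ℝ) • x2 + (257/25 : ℝ) • x3 - (2881/200 : ℝ) • x4
      + (2079/200 : ℝ) • x5 - (18/5 : ℝ) • x6),
    hn (x2 - (11/4 : ℝ) • x3 + (417/100 : ℝ) • x4 - (339/100 : ℝ) • x5 + (67/50 : ℝ) • x6),
    hn (x3 - (227/100 : ℝ) • x4 + (117/40 : ℝ) • x5 - (329/200 : ℝ) • x6),
    hn (x4 - (33/20 : ℝ) • x5 + (217/200 : ℝ) • x6),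
    hn (x5 - (19/20 : ℝ) • x6)]

lemma stateEnergy_dissipation (hs : ∀ x y, b x y = b y x) (hn : ∀ x, 0 ≤ b x x)
    (w x1 x2 x3 x4 : H) :
    stateEnergy b w x2 x3 x4 - stateEnergy b (w - x4) x1 x2 x3
      ≤ b (w + (2 : ℝ) • x4) ((10 : ℝ) • x4 - (12 : ℝ) • x3 + (8 : ℝ) • x2 - (3 : ℝ) • x1) := by
  have h0 := hn (x1 - (89/60 : ℝ) • x2 + (143/120 : ℝ) • x3 - (3/2 : ℝ) • x4)
  have h1 := hn (x2 - (427/722 : ℝ) • x3 + (300/361 : ℝ) • x4)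
  have h2 := hn (x3 - (12739/22379 : ℝ) • x4)
  have h3 := hn x4
  simp only [stateEnergy, map_add, map_sub, map_smul, LinearMap.add_apply, LinearMap.sub_apply,
    LinearMap.smul_apply, smul_eq_mul, hs x1 w, hs x2 w, hs x2 x1, hs x3 w, hs x3 x1, hs x3 x2,
    hs x4 w, hs x4 x1, hs x4 x2, hs x4 x3]
    at h0 h1 h2 h3 ⊢
  linarith

lemma stateEnergy_le (hs : ∀ x y, b x y = b y x) (hn : ∀ x, 0 ≤ b x x)
    (u0 u1 u2 u3 : H) :
    stateEnergy b u3 (u1 - u0) (u2 - u1) (u3 - u2)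
      ≤ 1000 * (b u0 u0 + b u1 u1 + b u2 u2 + b u3 u3) := by
  have h0 := hn (u0 + u1)
  have h1 := hn (u0 - u1)
  have h2 := hn (u0 + u2)
  have h3 := hn (u0 - u2)
  have h4 := hn (u1 + u2)
  have h5 := hn (u1 - u2)
  have h6 := hn (u0 + u3)
  have h7 := hn (u0 - u3)
  have h8 := hn (u1 + u3)
  have h9 := hn (u1 - u3)
  have h10 := hn (u2 + u3)
  have h11 := hn (u2 - u3)
  have h12 := hn u0
  have h13 := hn u1
  have h14 := hn u2
  have h15 := hn u3
  simp only [stateEnergy, map_add, map_sub, map_smul, LinearMap.add_apply, LinearMap.sub_apply,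
    LinearMap.smul_apply, smul_eq_mul, hs u1 u0, hs u2 u0, hs u2 u1, hs u3 u0, hs u3 u1, hs u3 u2]
    at h0 h1 h2 h3 h4 h5 h6 h7 h8 h9 h10 h11 h12 h13 h14 h15 ⊢
  linarith

lemma le_stateEnergy (hs : ∀ x y, b x y = b y x) (hn : ∀ x, 0 ≤ b x x)
    (w x2 x3 x4 : H) :
    1 / 100 * b w w ≤ stateEnergy b w x2 x3 x4 := by
  have h0 := hn (w + x2 - (5/3 : ℝ) • x3 + (7/3 : ℝ) • x4)
  have h1 := hn (x2 - (13/10 : ℝ) • x3 + (1/20 : ℝ) • x4)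
  have h2 := hn (x3 - (5/4 : ℝ) • x4)
  have h3 := hn x4
  have h4 := hn (w + (2 : ℝ) • x2 - (89/30 : ℝ) • x3 + (143/60 : ℝ) • x4)
  have h5 := hn (w - (11/30 : ℝ) • x3 + (137/60 : ℝ) • x4)
  have h6 := hn (w + x2 - (2/3 : ℝ) • x3 + (13/12 : ℝ) • x4)
  have h7 := hn (w + x2 - (8/3 : ℝ) • x3 + (43/12 : ℝ) • x4)
  have h8 := hn (x2 - (3/10 : ℝ) • x3 - (6/5 : ℝ) • x4)
  have h9 := hn (x2 - (23/10 : ℝ) • x3 + (13/10 : ℝ) • x4)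
  have h10 := hn (w + x2 - (5/3 : ℝ) • x3 + (10/3 : ℝ) • x4)
  have h11 := hn (w + x2 - (5/3 : ℝ) • x3 + (4/3 : ℝ) • x4)
  have h12 := hn (x2 - (13/10 : ℝ) • x3 + (21/20 : ℝ) • x4)
  have h13 := hn (x2 - (13/10 : ℝ) • x3 - (19/20 : ℝ) • x4)
  have h14 := hn (x3 - (1/4 : ℝ) • x4)
  have h15 := hn (x3 - (9/4 : ℝ) • x4)
  simp only [stateEnergy, map_add, map_sub, map_smul, LinearMap.add_apply, LinearMap.sub_apply,
    LinearMap.smul_apply, smul_eq_mul, hs x2 w, hs x3 w, hs x3 x2, hs x4 w, hs x4 x2, hs x4 x3]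
    at h0 h1 h2 h3 h4 h5 h6 h7 h8 h9 h10 h11 h12 h13 h14 h15 ⊢
  linarith

end Forms

section Scheme

variable {H : Type*} [NormedAddCommGroup H] [InnerProductSpace ℝ H]

/-- The form `(v, w) ↦ ⟪A v, w⟫`. -/
noncomputable def energyForm (A : H →L[ℝ] H) : LinearMap.BilinForm ℝ H :=
  (innerₗ H).comp (A : H →ₗ[ℝ] H)

@[simp]
lemma energyForm_apply (A : H →L[ℝ] H) (v w : H) : energyForm A v w = ⟪A v, w⟫ := rfl

lemma innerₗ_symm (x y : H) : innerₗ H x y = innerₗ H y x := real_inner_comm y x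

lemma innerₗ_nonneg (x : H) : 0 ≤ innerₗ H x x := real_inner_self_nonneg

/-- The energy of the WSBDF7 scheme after `n` steps. -/
noncomputable def wsbdf7Energy (A : H →L[ℝ] H) (τ : ℝ) (u : ℕ → H) (n : ℕ) : ℝ :=
  1 / 420 * τ⁻¹ * differenceEnergy (innerₗ H) (u (n + 1) - u n) (u (n + 2) - u (n + 1))
      (u (n + 3) - u (n + 2)) (u (n + 4) - u (n + 3)) (u (n + 5) - u (n + 4))
      (u (n + 6) - u (n + 5))
    + stateEnergy (energyForm A) (u (n + 6)) (u (n + 4) - u (n + 3)) (u (n + 5) - u (n + 4))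
      (u (n + 6) - u (n + 5))

lemma sum_alphaCoeff_smul (u : ℕ → H) (n : ℕ) :
    ∑ i : Fin 8, alphaCoeff i • u (n + i.1) = (1 / 420 : ℝ) •
      ((3147 : ℝ) • (u (n + 7) - u (n + 6)) - (6891 : ℝ) • (u (n + 6) - u (n + 5))
        + (8859 : ℝ) • (u (n + 5) - u (n + 4)) - (7941 : ℝ) • (u (n + 4) - u (n + 3))
        + (4484 : ℝ) • (u (n + 3) - u (n + 2)) - (1438 : ℝ) • (u (n + 2) - u (n + 1))
        + (200 : ℝ) • (u (n + 1) - u n)) := by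
  simp [Fin.sum_univ_eight, alphaCoeff]
  module

lemma norm_three_smul_sub_two_smul_sq_le (x y : H) :
    ‖(3 : ℝ) • x - (2 : ℝ) • y‖ ^ 2 ≤ 18 * ‖x‖ ^ 2 + 8 * ‖y‖ ^ 2 := by
  have h := sq_nonneg ‖(3 : ℝ) • x + (2 : ℝ) • y‖
  rw [norm_add_sq_real] at h
  rw [norm_sub_sq_real]
  simp only [norm_smul, Real.norm_ofNat, mul_pow] at h ⊢
  linarith

lemma wsbdf7Energy_succ_le {A : H →L[ℝ] H} (hA : ∀ v w : H, ⟪A v, w⟫ = ⟪v, A w⟫)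
    (hpos : ∀ v : H, 0 ≤ ⟪A v, v⟫) {τ : ℝ} (hτ : 0 < τ) {f u : ℕ → H} {n : ℕ}
    (hu : ∑ i : Fin 8, alphaCoeff i • u (n + i.1) + (3 * τ) • A (u (n + 7))
        - (2 * τ) • A (u (n + 6)) = (3 * τ) • f (n + 7) - (2 * τ) • f (n + 6)) :
    wsbdf7Energy A τ u (n + 1)
      ≤ wsbdf7Energy A τ u n + 1050 * τ * (18 * ‖f (n + 7)‖ ^ 2 + 8 * ‖f (n + 6)‖ ^ 2) := by
  have hs : ∀ x y, energyForm A x y = energyForm A y x := fun x y => by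
    simp [hA x y, real_inner_comm]
  have hD := differenceEnergy_dissipation innerₗ_symm innerₗ_nonneg
    (u (n + 1) - u n) (u (n + 2) - u (n + 1)) (u (n + 3) - u (n + 2)) (u (n + 4) - u (n + 3))
    (u (n + 5) - u (n + 4)) (u (n + 6) - u (n + 5)) (u (n + 7) - u (n + 6))
  have hU := stateEnergy_dissipation hs hpos (u (n + 7)) (u (n + 4) - u (n + 3))
    (u (n + 5) - u (n + 4)) (u (n + 6) - u (n + 5)) (u (n + 7) - u (n + 6))
  rw [sub_sub_cancel] at hU
  rw [sum_alphaCoeff_smul] at hu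
  set m := (10 : ℝ) • (u (n + 7) - u (n + 6)) - (12 : ℝ) • (u (n + 6) - u (n + 5))
    + (8 : ℝ) • (u (n + 5) - u (n + 4)) - (3 : ℝ) • (u (n + 4) - u (n + 3))
  set a := (3147 : ℝ) • (u (n + 7) - u (n + 6)) - (6891 : ℝ) • (u (n + 6) - u (n + 5))
    + (8859 : ℝ) • (u (n + 5) - u (n + 4)) - (7941 : ℝ) • (u (n + 4) - u (n + 3))
    + (4484 : ℝ) • (u (n + 3) - u (n + 2)) - (1438 : ℝ) • (u (n + 2) - u (n + 1))
    + (200 : ℝ) • (u (n + 1) - u n)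
  set g := (3 : ℝ) • f (n + 7) - (2 : ℝ) • f (n + 6) with hg
  clear_value a m
  have heq : (1 / 420 * τ⁻¹ : ℝ) • a + A (u (n + 7) + (2 : ℝ) • (u (n + 7) - u (n + 6))) = g := by
    have h := congrArg (fun x => τ⁻¹ • x) hu
    simp only [smul_add, smul_sub, smul_smul] at h
    have h3 : τ⁻¹ * (3 * τ) = 3 := by field_simp
    have h2 : τ⁻¹ * (2 * τ) = 2 := by field_simp
    rw [h3, h2] at h
    rw [hg, ← h]
    simp only [map_add, map_sub, map_smul]
    module
  have htest : 1 / 420 * τ⁻¹ * ⟪a, m⟫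
      + ⟪A (u (n + 7) + (2 : ℝ) • (u (n + 7) - u (n + 6))), m⟫ = ⟪g, m⟫ := by
    rw [← heq, inner_add_left, real_inner_smul_left]
  have hyoung : ⟪g, m⟫ ≤ 1 / 4200 * τ⁻¹ * ‖m‖ ^ 2 + 1050 * τ * ‖g‖ ^ 2 := by
    refine (real_inner_le_norm g m).trans ?_
    have h : 1 / 4200 * τ⁻¹ * ‖m‖ ^ 2 + 1050 * τ * ‖g‖ ^ 2 - ‖g‖ * ‖m‖
        = 1 / 4200 * τ⁻¹ * (‖m‖ - 2100 * τ * ‖g‖) ^ 2 := by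
      field_simp
      ring
    have : 0 ≤ 1 / 4200 * τ⁻¹ * (‖m‖ - 2100 * τ * ‖g‖) ^ 2 := by positivity
    linarith
  have hgf := mul_le_mul_of_nonneg_left (norm_three_smul_sub_two_smul_sq_le (f (n + 7)) (f (n + 6)))
    (by positivity : 0 ≤ 1050 * τ)
  have hD' := mul_le_mul_of_nonneg_left hD (by positivity : 0 ≤ 1 / 420 * τ⁻¹)
  simp only [innerₗ_apply_apply, energyForm_apply, real_inner_self_eq_norm_sq] at hD' hU
  simp only [wsbdf7Energy, add_assoc, Nat.reduceAdd]
  linarith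

lemma wsbdf7Energy_le {A : H →L[ℝ] H} (hA : ∀ v w : H, ⟪A v, w⟫ = ⟪v, A w⟫)
    (hpos : ∀ v : H, 0 ≤ ⟪A v, v⟫) {τ : ℝ} (hτ : 0 < τ) {f u : ℕ → H} {n : ℕ}
    (hu : ∀ k < n, ∑ i : Fin 8, alphaCoeff i • u (k + i.1) + (3 * τ) • A (u (k + 7))
        - (2 * τ) • A (u (k + 6)) = (3 * τ) • f (k + 7) - (2 * τ) • f (k + 6)) :
    wsbdf7Energy A τ u n + 8400 * τ * ‖f (n + 6)‖ ^ 2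
      ≤ wsbdf7Energy A τ u 0 + 27300 * τ * ∑ l ∈ Finset.Icc 6 (n + 6), ‖f l‖ ^ 2 := by
  induction n with
  | zero =>
    have : 0 ≤ τ * ‖f 6‖ ^ 2 := by positivity
    simp only [zero_add, Finset.Icc_self, Finset.sum_singleton]
    linarith
  | succ n ih =>
    have h := wsbdf7Energy_succ_le hA hpos hτ (hu n n.lt_succ_self)
    have ih' := ih fun k hk => hu k (hk.trans n.lt_succ_self)
    rw [show n + 1 + 6 = n + 6 + 1 by ring, Finset.sum_Icc_succ_top (by omega)]
    simp only [add_assoc, Nat.reduceAdd] at ih' ⊢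
    linarith

lemma wsbdf7Energy_zero_le {A : H →L[ℝ] H} (hA : ∀ v w : H, ⟪A v, w⟫ = ⟪v, A w⟫)
    (hpos : ∀ v : H, 0 ≤ ⟪A v, v⟫) {τ : ℝ} (hτ : 0 < τ) (u : ℕ → H) :
    wsbdf7Energy A τ u 0 ≤ 1000 * ∑ j ∈ Finset.range 7, ⟪A (u j), u j⟫
      + 2500 * τ⁻¹ * ∑ j ∈ Finset.Icc 1 6, ‖u j - u (j - 1)‖ ^ 2 := by
  have hs : ∀ x y, energyForm A x y = energyForm A y x := fun x y => by
    simp [hA x y, real_inner_comm]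
  have hU := stateEnergy_le hs hpos (u 3) (u 4) (u 5) (u 6)
  have hD := mul_le_mul_of_nonneg_left
    (differenceEnergy_le innerₗ_symm innerₗ_nonneg (u 1 - u 0) (u 2 - u 1) (u 3 - u 2)
      (u 4 - u 3) (u 5 - u 4) (u 6 - u 5)) (by positivity : 0 ≤ 1 / 420 * τ⁻¹)
  have hsum : 0 ≤ τ⁻¹ * ∑ j ∈ Finset.Icc 1 6, ‖u j - u (j - 1)‖ ^ 2 := by positivity
  rw [show Finset.Icc 1 6 = {1, 2, 3, 4, 5, 6} from rfl] at hsum ⊢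
  simp only [innerₗ_apply_apply, energyForm_apply, real_inner_self_eq_norm_sq] at hD hU
  simp [Finset.sum_range_succ, wsbdf7Energy] at hsum ⊢
  linarith [hpos (u 0), hpos (u 1), hpos (u 2)]

lemma le_wsbdf7Energy {A : H →L[ℝ] H} (hA : ∀ v w : H, ⟪A v, w⟫ = ⟪v, A w⟫)
    (hpos : ∀ v : H, 0 ≤ ⟪A v, v⟫) {τ : ℝ} (hτ : 0 < τ) (u : ℕ → H) (n : ℕ) :
    1 / 100 * (⟪A (u (n + 6)), u (n + 6)⟫ + τ⁻¹ * ‖u (n + 6) - u (n + 5)‖ ^ 2)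
      ≤ wsbdf7Energy A τ u n := by
  have hs : ∀ x y, energyForm A x y = energyForm A y x := fun x y => by
    simp [hA x y, real_inner_comm]
  have hU := le_stateEnergy hs hpos (u (n + 6)) (u (n + 4) - u (n + 3)) (u (n + 5) - u (n + 4))
    (u (n + 6) - u (n + 5))
  have hD := mul_le_mul_of_nonneg_left
    (le_differenceEnergy innerₗ_nonneg (u (n + 1) - u n) (u (n + 2) - u (n + 1))
      (u (n + 3) - u (n + 2)) (u (n + 4) - u (n + 3)) (u (n + 5) - u (n + 4))
      (u (n + 6) - u (n + 5))) (by positivity : 0 ≤ 1 / 420 * τ⁻¹)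
  have h0 : 0 ≤ τ⁻¹ * ‖u (n + 6) - u (n + 5)‖ ^ 2 := by positivity
  simp only [innerₗ_apply_apply, energyForm_apply, real_inner_self_eq_norm_sq] at hD hU
  rw [wsbdf7Energy]
  linarith

lemma mul_norm_one_div_smul_sq {τ : ℝ} (hτ : 0 < τ) (x : H) :
    τ * ‖(1 / τ) • x‖ ^ 2 = τ⁻¹ * ‖x‖ ^ 2 := by
  rw [norm_smul, Real.norm_of_nonneg (by positivity)]
  field_simp

end Scheme

/-- Third stability estimate for the WSBDF7 method with weight θ = 3:
`‖uⁿ‖² + τ|∂_τ uⁿ|² ≤ C Σ_{j=0}^{6} ‖u^j‖² + C τ Σ_{j=1}^{6} |∂_τ u^j|²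
 + C τ Σ_{ℓ=6}^{n} |f^ℓ|²`, where `∂_τ uⁿ = (uⁿ − u^{n−1})/τ` and `‖v‖² = (Av,v)`. -/
theorem wsbdf7_third_stability :
    ∃ C : ℝ, 0 < C ∧
      ∀ (H : Type) [_i1 : NormedAddCommGroup H] [_i2 : InnerProductSpace ℝ H]
        [_i3 : CompleteSpace H]
        (A B : H →L[ℝ] H),
        (∀ v w : H, ⟪A v, w⟫ = ⟪v, A w⟫) →
        (∃ lam : ℝ, 0 < lam ∧ ∀ v : H, lam * ‖v‖ ^ 2 ≤ ⟪A v, v⟫) →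
        (∀ v : H, A (B v) = v) → (∀ v : H, B (A v) = v) →
        ∀ τ : ℝ, 0 < τ → ∀ N : ℕ, 7 ≤ N →
        ∀ f u : ℕ → H,
          (∀ n : ℕ, n ≤ N - 7 →
            ∑ i : Fin 8, alphaCoeff i • u (n + i.1) + (3 * τ) • A (u (n + 7))
              - (2 * τ) • A (u (n + 6))
            = (3 * τ) • f (n + 7) - (2 * τ) • f (n + 6)) →
          ∀ n : ℕ, 7 ≤ n → n ≤ N →
            ⟪A (u n), u n⟫ + τ * ‖(1 / τ) • (u n - u (n - 1))‖ ^ 2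
              ≤ C * ∑ j ∈ Finset.range 7, ⟪A (u j), u j⟫
                + C * τ * ∑ j ∈ Finset.Icc 1 6, ‖(1 / τ) • (u j - u (j - 1))‖ ^ 2
                + C * τ * ∑ ℓ ∈ Finset.Icc 6 n, ‖f ℓ‖ ^ 2 := by
  refine ⟨10 ^ 7, by norm_num, ?_⟩
  intro H _ _ _ A B hA hcoer _ _ τ hτ N hN f u hu n hn hnN
  obtain ⟨lam, hlam, hcoer⟩ := hcoer
  have hpos : ∀ v : H, 0 ≤ ⟪A v, v⟫ := fun v => le_trans (by positivity) (hcoer v)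
  obtain ⟨k, rfl⟩ : ∃ k, n = k + 6 := ⟨n - 6, by omega⟩
  have hE := wsbdf7Energy_le hA hpos hτ (n := k) fun j hj => hu j (by omega)
  have hlow := le_wsbdf7Energy hA hpos hτ u k
  have hini := wsbdf7Energy_zero_le hA hpos hτ u
  have hf : 0 ≤ τ * ‖f (k + 6)‖ ^ 2 := by positivity
  have hfs : 0 ≤ τ * ∑ l ∈ Finset.Icc 6 (k + 6), ‖f l‖ ^ 2 := by positivity
  have hds : 0 ≤ τ⁻¹ * ∑ j ∈ Finset.Icc 1 6, ‖u j - u (j - 1)‖ ^ 2 := by positivity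
  have hus : 0 ≤ ∑ j ∈ Finset.range 7, ⟪A (u j), u j⟫ := Finset.sum_nonneg fun j _ => hpos (u j)
  rw [mul_assoc _ τ, Finset.mul_sum (Finset.Icc 1 6)]
  simp only [mul_norm_one_div_smul_sq hτ, Nat.add_succ_sub_one]
  rw [← Finset.mul_sum]
  linarith
end

section
/- There exists a constant C > 0 with the following property: for every real Hilbert space H, every bounded selfadjoint coercive operator A on H, every T > 0 and integer N ≥ 7 with τ := T/N and t_n := nτ, every eight times continuously differentiable u : [0, T] → H satisfying u′(t) + Au(t) = f(t) on [0, T], every C₀ ≥ 0, and every choice of starting values u⁰,…,u⁶ ∈ H satisfying |u(t_i) − u^i| + τ^{1/2}‖u(t_i) − u^i‖ ≤ C₀ τ⁷ for i = 0,…,6, the WSBDF7 approximations u⁷,…,u^N (computed with data f^m := f(t_m)) satisfy |u(t_n) − uⁿ| + τ^{1/2}‖u(t_n) − uⁿ‖ ≤ C (C₀ + T^{1/2} M) τ⁷ for all n = 0,…,N, where M := sup_{t ∈ [0,T]} ‖u⁽⁸⁾(t)‖_⋆. (Optimal-order error estimate of order 7 for the WSBDF7 method with θ = 3.) -/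
open scoped RealInnerProductSpace

section QuadraticForms

variable {H : Type*} [AddCommGroup H] [Module ℝ H]

/-- The quadratic form with rational matrix `M` evaluated on the Gram matrix of `x` under `b`. -/
noncomputable def gramForm {n : ℕ} (b : LinearMap.BilinForm ℝ H) (M : Matrix (Fin n) (Fin n) ℚ)
    (x : Fin n → H) : ℝ :=
  ∑ i, ∑ j, (M i j : ℝ) * b (x i) (x j)

/-- The linear combination of `x` with rational coefficients `p`. -/
noncomputable def ratComb {n : ℕ} (p : Fin n → ℚ) (x : Fin n → H) : H :=
  ∑ i, (p i : ℝ) • x i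

variable {n r : ℕ} (b : LinearMap.BilinForm ℝ H)

lemma gramForm_add (M M' : Matrix (Fin n) (Fin n) ℚ) (x : Fin n → H) :
    gramForm b (M + M') x = gramForm b M x + gramForm b M' x := by
  simp [gramForm, add_mul, Finset.sum_add_distrib]

lemma gramForm_smul (c : ℚ) (M : Matrix (Fin n) (Fin n) ℚ) (x : Fin n → H) :
    gramForm b (c • M) x = c * gramForm b M x := by
  simp [gramForm, Finset.mul_sum, mul_assoc]

lemma gramForm_vecMulVec (p q : Fin n → ℚ) (x : Fin n → H) :
    gramForm b (Matrix.vecMulVec p q) x = b (ratComb p x) (ratComb q x) := by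
  simp only [gramForm, ratComb, Matrix.vecMulVec_apply, map_sum, LinearMap.sum_apply, map_smul,
    LinearMap.smul_apply, smul_eq_mul, Finset.mul_sum, Rat.cast_mul]
  rw [Finset.sum_comm]
  exact Finset.sum_congr rfl fun j _ => Finset.sum_congr rfl fun i _ => by ring

lemma gramForm_sum (M : Fin r → Matrix (Fin n) (Fin n) ℚ) (x : Fin n → H) :
    gramForm b (∑ k, M k) x = ∑ k, gramForm b (M k) x := by
  induction r with
  | zero => simp [gramForm]
  | succ r ih => rw [Fin.sum_univ_succ, Fin.sum_univ_succ, gramForm_add, ih]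

/-- The weighted sum of squares `∑ₖ wₖ Lₖ Lₖᵀ` of the rows of `L`. -/
def weightedSquares (w : Fin r → ℚ) (L : Matrix (Fin r) (Fin n) ℚ) : Matrix (Fin n) (Fin n) ℚ :=
  fun i j => ∑ k, w k * (L k i * L k j)

lemma gramForm_weightedSquares_nonneg (hb : ∀ x, 0 ≤ b x x) {w : Fin r → ℚ} (hw : ∀ k, 0 ≤ w k)
    (L : Matrix (Fin r) (Fin n) ℚ) (x : Fin n → H) :
    0 ≤ gramForm b (weightedSquares w L) x := by
  have h : weightedSquares w L = ∑ k, w k • Matrix.vecMulVec (L k) (L k) := by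
    ext i j
    simp [weightedSquares, Matrix.sum_apply, Matrix.vecMulVec_apply]
  rw [h, gramForm_sum]
  refine Finset.sum_nonneg fun k _ => ?_
  rw [gramForm_smul, gramForm_vecMulVec]
  exact mul_nonneg (by exact_mod_cast hw k) (hb _)

/-- The matrix `M` bordered by a zero first row and a zero first column. -/
def padFirst (M : Matrix (Fin n) (Fin n) ℚ) : Matrix (Fin (n + 1)) (Fin (n + 1)) ℚ :=
  Fin.cons 0 fun i => Fin.cons 0 (M i)

/-- The matrix `M` bordered by a zero last row and a zero last column. -/
def padLast (M : Matrix (Fin n) (Fin n) ℚ) : Matrix (Fin (n + 1)) (Fin (n + 1)) ℚ :=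
  Fin.snoc (α := fun _ => Fin (n + 1) → ℚ) (fun i => Fin.snoc (α := fun _ => ℚ) (M i) 0) 0

lemma gramForm_padFirst (M : Matrix (Fin n) (Fin n) ℚ) (x : Fin (n + 1) → H) :
    gramForm b (padFirst M) x = gramForm b M (Fin.tail x) := by
  simp [gramForm, padFirst, Fin.sum_univ_succ, Fin.tail]

lemma gramForm_padLast (M : Matrix (Fin n) (Fin n) ℚ) (x : Fin (n + 1) → H) :
    gramForm b (padLast M) x = gramForm b M (Fin.init x) := by
  simp [gramForm, padLast, Fin.sum_univ_castSucc, Fin.init]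

/-- One step of the energy method: a sum-of-squares decomposition of the defect turns testing
`p` against the multiplier `m` into the growth of the energy with matrix `G`. -/
lemma gramForm_tail_le (hs : ∀ x y, b x y = b y x) (hb : ∀ x, 0 ≤ b x x)
    {p m : Fin (n + 1) → ℚ} {δ : ℚ} {G : Matrix (Fin n) (Fin n) ℚ} {w : Fin r → ℚ}
    {L : Matrix (Fin r) (Fin (n + 1)) ℚ} (hw : ∀ k, 0 ≤ w k)
    (h : ∀ i j, p i * m j + m i * p j + padLast G i j =
      padFirst G i j + δ * (m i * m j) + weightedSquares w L i j) (x : Fin (n + 1) → H) :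
    gramForm b G (Fin.tail x) + δ * b (ratComb m x) (ratComb m x) ≤
      gramForm b G (Fin.init x) + 2 * b (ratComb p x) (ratComb m x) := by
  have h' : Matrix.vecMulVec p m + Matrix.vecMulVec m p + padLast G =
      padFirst G + δ • Matrix.vecMulVec m m + weightedSquares w L := by
    ext i j
    simpa [Matrix.vecMulVec_apply] using h i j
  have key := congrArg (fun M => gramForm b M x) h'
  simp only [gramForm_add, gramForm_smul, gramForm_vecMulVec, gramForm_padFirst,
    gramForm_padLast] at key
  rw [hs (ratComb m x) (ratComb p x)] at key
  linarith [gramForm_weightedSquares_nonneg b hb hw L x]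

lemma le_gramForm_of_last (hb : ∀ x, 0 ≤ b x x)
    {G : Matrix (Fin (n + 1)) (Fin (n + 1)) ℚ} {w : Fin r → ℚ}
    {L : Matrix (Fin r) (Fin (n + 1)) ℚ} (hw : ∀ k, 0 ≤ w k)
    (h : ∀ i j, G i j - Matrix.single (Fin.last n) (Fin.last n) 1 i j - weightedSquares w L i j = 0)
    (x : Fin (n + 1) → H) :
    b (x (Fin.last n)) (x (Fin.last n)) ≤ gramForm b G x := by
  have h' : G = Matrix.single (Fin.last n) (Fin.last n) 1 + weightedSquares w L := by
    ext i j
    simpa [sub_sub, sub_eq_zero] using h i j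
  have hx : gramForm b (Matrix.single (Fin.last n) (Fin.last n) 1) x =
      b (x (Fin.last n)) (x (Fin.last n)) := by
    simp [gramForm, Matrix.single_apply, ite_and, apply_ite (Rat.cast : ℚ → ℝ)]
  rw [h', gramForm_add, hx]
  linarith [gramForm_weightedSquares_nonneg b hb hw L x]

/-- The sum of the absolute values of the entries of `M`. -/
def absSum (M : Matrix (Fin n) (Fin n) ℚ) : ℚ := ∑ i, ∑ j, |M i j|

lemma gramForm_le (hs : ∀ x y, b x y = b y x) (hb : ∀ x, 0 ≤ b x x)
    (M : Matrix (Fin n) (Fin n) ℚ) {x : Fin n → H} {c : ℝ} (hx : ∀ i, b (x i) (x i) ≤ c) :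
    gramForm b M x ≤ absSum M * c := by
  have hc : ∀ i j, |b (x i) (x j)| ≤ c := by
    intro i j
    have h1 := hb (x i - x j)
    have h2 := hb (x i + x j)
    simp only [map_sub, map_add, LinearMap.sub_apply, LinearMap.add_apply] at h1 h2
    rw [hs (x j) (x i)] at h1 h2
    rw [abs_le]
    constructor <;> linarith [hx i, hx j]
  simp only [absSum, Rat.cast_sum, Finset.sum_mul, gramForm]
  refine Finset.sum_le_sum fun i _ => Finset.sum_le_sum fun j _ => ?_
  calc (M i j : ℝ) * b (x i) (x j) ≤ |(M i j : ℝ) * b (x i) (x j)| := le_abs_self _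
    _ = |(M i j : ℝ)| * |b (x i) (x j)| := abs_mul _ _
    _ ≤ |(M i j : ℝ)| * c := by gcongr; exact hc i j
    _ = _ := by simp

end QuadraticForms

/-- The coefficients of `420 α`. -/
def scaledAlpha : Fin 8 → ℚ := ![-200, 1638, -5922, 12425, -16800, 15750, -10038, 3147]

/-- The coefficients of `420 β`, where `β(ζ) = 3ζ⁷ − 2ζ⁶`. -/
def scaledBeta : Fin 8 → ℚ := ![0, 0, 0, 0, 0, 0, -840, 1260]

/-- The coefficients of the multiplier against which the error equation is tested. -/
def multiplier : Fin 8 → ℚ := ![2, -9, 17, -19, 7, 15, -26, 14]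

/-- Dahlquist matrix of the multiplier with respect to `420 α`. -/
def gramAlpha : Matrix (Fin 7) (Fin 7) ℚ := ![
    ![15553, -33310, 37437, -41509, 33644, -12915, 1300],
    ![-33310, 99103, -156969, 205008, -201578, 120980, -34672],
    ![37437, -156969, 333913, -500098, 530020, -357025, 117206],
    ![-41509, 205008, -500098, 817321, -905108, 629294, -212849],
    ![33644, -201578, 530020, -905108, 1052681, -764809, 264009],
    ![-12915, 120980, -357025, 629294, -764809, 596701, -219117],
    ![1300, -34672, 117206, -212849, 264009, -219117, 87270]]

/-- Dahlquist matrix of the multiplier with respect to `420 β`. -/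
def gramBeta : Matrix (Fin 7) (Fin 7) ℚ := ![
    ![12191, -16566, 11820, -1420, -9948, 13209, -7816],
    ![-16566, 34890, -32791, 13875, 12103, -28056, 18762],
    ![11820, -32791, 46679, -34456, 4318, 25159, -23390],
    ![-1420, 13875, -34456, 47250, -33455, 2532, 10768],
    ![-9948, 12103, 4318, -33455, 55530, -44170, 15983],
    ![13209, -28056, 25159, 2532, -44170, 70122, -42217],
    ![-7816, 18762, -23390, 10768, 15983, -42217, 34520]]

/-- Weights of a sum-of-squares decomposition of the defect in the `α` telescoping identity. -/
def alphaDefectWeight : Fin 7 → ℚ := ![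
    1 / 14753,
    1 / 7036325326,
    1 / 4815781147110,
    1 / 1888665060293115,
    3 / 220290598300466837,
    12 / 2553735136378784303,
    38448373533 / 2168371357]

/-- Vectors of a sum-of-squares decomposition of the defect in the `α` telescoping identity. -/
def alphaDefectVector : Matrix (Fin 7) (Fin 8) ℚ := ![
    ![-14753, 28234, -22193, 12859, 1356, -15585, 13576, -3494],
    ![0, -476942, 626633, -216866, -28237, 261642, -228957, 62727],
    ![0, 0, -10097205, 10892768, -167505, -2440934, 2468587, -655711],
    ![0, 0, 0, -187048303, 175764330, 32589184, -22775417, 1470206],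
    ![0, 0, 0, 0, -1177720379, 1284131677, -153927948, 47516650],
    ![0, 0, 0, 0, 0, -2168371357, 2309073075, -140701718],
    ![0, 0, 0, 0, 0, 0, -1, 1]]

/-- Weights of a sum-of-squares decomposition of the defect in the `β` telescoping identity. -/
def betaDefectWeight : Fin 8 → ℚ := ![
    1 / 12187,
    1 / 449989306,
    1 / 57452434527488,
    1 / 53289474006881024,
    1 / 43069892140749368273,
    2 / 87413140786954334907433,
    1 / 670436329285779852153797198,
    10356241894364358 / 196843074664063]

/-- Vectors of a sum-of-squares decomposition of the defect in the `β` telescoping identity. -/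
def betaDefectVector : Matrix (Fin 8) (Fin 8) ℚ := ![
    ![12187, -16548, 11786, -1382, -9962, 13179, -9444, 2492],
    ![0, 258466, -119248, 12996, 103058, -135837, 96723, -24830],
    ![0, 0, 63509248, -1835718, -13097456, 17770233, -11862236, 3090724],
    ![0, 0, 0, 1678164226, 29184592, -64043123, 28021748, -18815372],
    ![0, 0, 0, 0, 51329770321, -9997689560, 6993516902, -2153809900],
    ![0, 0, 0, 0, 0, 1702971594073, -250276351348, 81659361290],
    ![0, 0, 0, 0, 0, 0, 196843074664063, -3701196936328],
    ![0, 0, 0, 0, 0, 0, 0, 1]]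

/-- Weights of a sum-of-squares decomposition showing that `gramAlpha` dominates the last square. -/
def gramAlphaLowerWeight : Fin 7 → ℚ := ![
    1 / 15553,
    1 / 6715674336027,
    1 / 650567927081211224437,
    1 / 4052941162204669516455596729367,
    1 / 1850327257718875520800734837796107105213,
    1 / 419142476906171796471496598382089468459236027476,
    20084755706655449066333433823 / 67705465030018118972048932]

/-- Vectors of a sum-of-squares decomposition showing that `gramAlpha` dominates the last square. -/
def gramAlphaLowerVector : Matrix (Fin 7) (Fin 7) ℚ := ![
    ![15553, -33310, 37437, -41509, 33644, -12915, 1300],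
    ![0, 431792859, -1194312387, 1805824634, -2014460994, 1451403290, -495950616],
    ![0, 0, 4520000135629, -11375776919999, 13066927041190, -9761532590000, 3724529547530],
    ![0, 0, 0, 298889457270681041, -612189124498314726, 459116651575038053, -147709341636790329],
    ![0, 0, 0, 0, 6190674219877810472493, -10786771732578134987975, 4575864823884667438195],
    ![0, 0, 0, 0, 0, 67705465030018118972048932, -71554116328725749387951273],
    ![0, 0, 0, 0, 0, 0, 1]]

/-- Weights of a sum-of-squares decomposition showing that `gramBeta` dominates the last square. -/
def gramBetaLowerWeight : Fin 7 → ℚ := ![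
    1 / 12191,
    1 / 1839763730094,
    1 / 287198264035796570670,
    1 / 46404315673049217367799035555,
    1 / 7734515564082634041984874178524981591,
    1 / 1332897034033749262278249135948889649258771475,
    19987282090337686329096968684 / 4202065012275873561702225]

/-- Vectors of a sum-of-squares decomposition showing that `gramBeta` dominates the last square. -/
def gramBetaLowerVector : Matrix (Fin 7) (Fin 7) ℚ := ![
    ![12191, -16566, 11820, -1420, -9948, 13209, -7816],
    ![0, 150911634, -203944961, 145626405, -17250895, -123210402, 99247686],
    ![0, 0, 1903088956255, -2555833513749, 1818625665707, -197146723656, -725864882274],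
    ![0, 0, 0, 24383681866540861, -32474191230052848, 22968079717189569, -8483897969711524],
    ![0, 0, 0, 0, 317200478845481040931, -420007165453881429327, 224206654473496057899],
    ![0, 0, 0, 0, 0, 4202065012275873561702225, -3560786153567934132316336],
    ![0, 0, 0, 0, 0, 0, 1]]

section Energy

variable {H : Type*} [AddCommGroup H] [Module ℝ H] {b : LinearMap.BilinForm ℝ H}

lemma gramAlpha_step (hs : ∀ x y, b x y = b y x) (hb : ∀ x, 0 ≤ b x x) (x : Fin 8 → H) :
    gramForm b gramAlpha (Fin.tail x) ≤ gramForm b gramAlpha (Fin.init x) +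
      2 * b (ratComb scaledAlpha x) (ratComb multiplier x) := by
  have h := gramForm_tail_le b hs hb (p := scaledAlpha) (m := multiplier) (δ := 0)
    (G := gramAlpha) (w := alphaDefectWeight) (L := alphaDefectVector)
    (by decide +kernel) (by decide +kernel) x
  simpa using h

lemma gramBeta_step (hs : ∀ x y, b x y = b y x) (hb : ∀ x, 0 ≤ b x x) (x : Fin 8 → H) :
    gramForm b gramBeta (Fin.tail x) + b (ratComb multiplier x) (ratComb multiplier x) ≤
      gramForm b gramBeta (Fin.init x) +
        2 * b (ratComb scaledBeta x) (ratComb multiplier x) := by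
  have h := gramForm_tail_le b hs hb (p := scaledBeta) (m := multiplier) (δ := 1)
    (G := gramBeta) (w := betaDefectWeight) (L := betaDefectVector)
    (by decide +kernel) (by decide +kernel) x
  simpa using h

lemma le_gramForm_gramAlpha (hb : ∀ x, 0 ≤ b x x) (x : Fin 7 → H) :
    b (x 6) (x 6) ≤ gramForm b gramAlpha x :=
  le_gramForm_of_last b hb (w := gramAlphaLowerWeight) (L := gramAlphaLowerVector)
    (by decide +kernel) (by decide +kernel) x

lemma le_gramForm_gramBeta (hb : ∀ x, 0 ≤ b x x) (x : Fin 7 → H) :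
    b (x 6) (x 6) ≤ gramForm b gramBeta x :=
  le_gramForm_of_last b hb (w := gramBetaLowerWeight) (L := gramBetaLowerVector)
    (by decide +kernel) (by decide +kernel) x

end Energy

section Truncation

open Set

/-- Taylor's theorem with a remainder bound, phrased with global iterated derivatives. -/
lemma abs_sub_taylor_le {φ : ℝ → ℝ} {n : ℕ} (hφ : ContDiff ℝ (n + 1) φ) {a s K : ℝ} (hs : 0 ≤ s)
    (hK : ∀ t ∈ Icc a (a + s), |iteratedDeriv (n + 1) φ t| ≤ K) :
    |φ (a + s) - ∑ k ∈ Finset.range (n + 1), iteratedDeriv k φ a * s ^ k / k.factorial| ≤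
      K * s ^ (n + 1) / (n + 1).factorial := by
  rcases hs.eq_or_lt with rfl | hs
  · simp [Finset.sum_range_succ']
  obtain ⟨y, hy, h⟩ := taylor_mean_remainder_lagrange_iteratedDeriv (f := φ) (n := n)
    (x₀ := a) (x := a + s) (by linarith) hφ.contDiffOn
  have hu : uIcc a (a + s) = Icc a (a + s) := uIcc_of_le (by linarith)
  rw [uIoo_of_le (by linarith)] at hy
  rw [hu, taylor_within_apply, add_sub_cancel_left] at h
  have hsum : ∑ k ∈ Finset.range (n + 1), iteratedDeriv k φ a * s ^ k / k.factorial =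
      ∑ k ∈ Finset.range (n + 1),
        ((k.factorial : ℝ)⁻¹ * s ^ k) • iteratedDerivWithin k φ (Icc a (a + s)) a := by
    refine Finset.sum_congr rfl fun k hk => ?_
    rw [iteratedDerivWithin_eq_iteratedDeriv (uniqueDiffOn_Icc (by linarith))
      (hφ.contDiffAt.of_le (by exact_mod_cast (Finset.mem_range.1 hk).le)) ⟨le_rfl, by linarith⟩,
      smul_eq_mul]
    ring
  rw [hsum, h, abs_div, abs_mul, abs_of_pos (pow_pos hs (n + 1)), Nat.abs_cast]
  gcongr
  exact hK y ⟨hy.1.le, hy.2.le⟩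

/-- The WSBDF7 method has consistency order seven. -/
lemma abs_truncation_le {φ : ℝ → ℝ} (hφ : ContDiff ℝ 8 φ) {a τ K : ℝ} (hτ : 0 ≤ τ)
    (hK : ∀ t ∈ Icc a (a + 7 * τ), |iteratedDeriv 8 φ t| ≤ K) :
    |∑ i : Fin 8, alphaCoeff i * φ (a + i * τ)
      - τ * (3 * deriv φ (a + 7 * τ) - 2 * deriv φ (a + 6 * τ))| ≤ 25000 * τ ^ 8 * K := by
  have hK0 : 0 ≤ K := (abs_nonneg _).trans (hK a ⟨le_rfl, by linarith⟩)
  have hρ : 0 ≤ τ ^ 8 * K := by positivity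
  have hvalue : ∀ c : ℝ, 0 ≤ c → c ≤ 7 →
      |φ (a + c * τ) - ∑ k ∈ Finset.range 8, iteratedDeriv k φ a * (c * τ) ^ k / k.factorial| ≤
        150 * (τ ^ 8 * K) := by
    intro c hc hc7
    have h := abs_sub_taylor_le (n := 7) (hφ.of_le (by norm_num)) (a := a) (s := c * τ) (K := K)
      (by positivity) fun t ht => hK t ⟨ht.1, ht.2.trans (by gcongr)⟩
    refine h.trans ?_
    have hc8 : c ^ 8 ≤ 7 ^ 8 := by gcongr
    norm_num [Nat.factorial]
    rw [mul_pow, div_le_iff₀ (by norm_num)]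
    nlinarith [mul_le_mul_of_nonneg_right hc8 hρ]
  have hderiv : ∀ c : ℝ, 0 ≤ c → c ≤ 7 →
      |τ * (deriv φ (a + c * τ) -
        ∑ k ∈ Finset.range 7, iteratedDeriv (k + 1) φ a * (c * τ) ^ k / k.factorial)| ≤
        164 * (τ ^ 8 * K) := by
    intro c hc hc7
    have hd : ContDiff ℝ 7 (deriv φ) :=
      ((contDiff_succ_iff_deriv (n := 7)).1 (hφ.of_le (by norm_num))).2.2
    have h := abs_sub_taylor_le (n := 6) (φ := deriv φ) (hd.of_le (by norm_num))
      (a := a) (s := c * τ) (K := K) (by positivity) fun t ht => by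
        rw [← iteratedDeriv_succ']
        exact hK t ⟨ht.1, ht.2.trans (by gcongr)⟩
    simp only [← iteratedDeriv_succ'] at h
    rw [abs_mul, abs_of_nonneg hτ]
    refine (mul_le_mul_of_nonneg_left h hτ).trans ?_
    have hc8 : c ^ 7 ≤ 7 ^ 7 := by gcongr
    norm_num [Nat.factorial]
    rw [mul_pow, mul_div_assoc', div_le_iff₀ (by norm_num)]
    nlinarith [mul_le_mul_of_nonneg_right hc8 hρ]
  set R : ℝ → ℝ := fun c =>
    φ (a + c * τ) - ∑ k ∈ Finset.range 8, iteratedDeriv k φ a * (c * τ) ^ k / k.factorial with hR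
  set S : ℝ → ℝ := fun c => τ * (deriv φ (a + c * τ) -
    ∑ k ∈ Finset.range 7, iteratedDeriv (k + 1) φ a * (c * τ) ^ k / k.factorial) with hS
  have hsplit : ∑ i : Fin 8, alphaCoeff i * φ (a + i * τ)
      - τ * (3 * deriv φ (a + 7 * τ) - 2 * deriv φ (a + 6 * τ)) =
      ∑ i : Fin 8, alphaCoeff i * R i - (3 * S 7 - 2 * S 6) := by
    simp [hR, hS, alphaCoeff, Fin.sum_univ_eight, Finset.sum_range_succ, Nat.factorial]
    ring
  have hsum : |∑ i : Fin 8, alphaCoeff i * R i| ≤ 157 * (150 * (τ ^ 8 * K)) := by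
    have habs : ∑ i : Fin 8, |alphaCoeff i| ≤ 157 := by
      simp [alphaCoeff, Fin.sum_univ_eight, abs_div, abs_neg]
      norm_num
    refine (Finset.abs_sum_le_sum_abs _ _).trans ?_
    refine le_trans ?_ (mul_le_mul_of_nonneg_right habs (by positivity))
    rw [Finset.sum_mul]
    refine Finset.sum_le_sum fun i _ => ?_
    rw [abs_mul]
    gcongr
    exact hvalue i (by positivity) (by exact_mod_cast Nat.le_of_lt_succ i.2)
  have h6 := abs_le.1 (hderiv 6 (by norm_num) (by norm_num))
  have h7 := abs_le.1 (hderiv 7 (by norm_num) (by norm_num))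
  rw [hsplit, abs_le]
  constructor <;> linarith [(abs_le.1 hsum).1, (abs_le.1 hsum).2, h6.1, h6.2, h7.1, h7.2]

end Truncation

section ErrorEstimate

variable {H : Type*} [NormedAddCommGroup H] [InnerProductSpace ℝ H]

/-- The bilinear form `(x, y) ↦ (A x, y)`. -/
noncomputable def operatorForm (A : H →L[ℝ] H) : LinearMap.BilinForm ℝ H :=
  (innerₗ H) ∘ₗ (A : H →ₗ[ℝ] H)

@[simp]
lemma operatorForm_apply (A : H →L[ℝ] H) (x y : H) : operatorForm A x y = ⟪A x, y⟫ := rfl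

/-- The discrete energy of seven consecutive errors. -/
noncomputable def energy (A : H →L[ℝ] H) (τ : ℝ) (x : Fin 7 → H) : ℝ :=
  gramForm (innerₗ H) gramAlpha x + τ * gramForm (operatorForm A) gramBeta x

lemma energy_step {A : H →L[ℝ] H} (hA : ∀ v w : H, ⟪A v, w⟫ = ⟪v, A w⟫)
    (hpos : ∀ v : H, 0 ≤ ⟪A v, v⟫) {τ : ℝ} (hτ : 0 ≤ τ) {x : Fin 8 → H} {d : H}
    (hd : ∑ i, alphaCoeff i • x i + (3 * τ) • A (x 7) - (2 * τ) • A (x 6) = d) :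
    energy A τ (Fin.tail x) +
        τ * ⟪A (ratComb multiplier x), ratComb multiplier x⟫ ≤
      energy A τ (Fin.init x) + 840 * ⟪d, ratComb multiplier x⟫ := by
  have hα := gramAlpha_step (b := innerₗ H) (fun x y => real_inner_comm y x)
    (fun x => real_inner_self_nonneg) x
  have hβ := gramBeta_step (b := operatorForm A)
    (fun x y => by simp [hA x y, real_inner_comm]) hpos x
  have hαd : ratComb scaledAlpha x = (420 : ℝ) • ∑ i, alphaCoeff i • x i := by
    simp only [ratComb, Finset.smul_sum, smul_smul]
    refine Finset.sum_congr rfl fun i _ => ?_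
    congr 1
    fin_cases i <;> norm_num [scaledAlpha, alphaCoeff]
  have hβd : ratComb scaledBeta x = (420 : ℝ) • ((3 : ℝ) • x 7 - (2 : ℝ) • x 6) := by
    simp only [ratComb, scaledBeta, Fin.sum_univ_eight]
    simp
    module
  simp only [innerₗ_apply_apply, operatorForm_apply] at hα hβ
  rw [hαd] at hα
  rw [hβd] at hβ
  have hsum : (420 : ℝ) • d = (420 : ℝ) • (∑ i, alphaCoeff i • x i) +
      τ • A ((420 : ℝ) • ((3 : ℝ) • x 7 - (2 : ℝ) • x 6)) := by
    rw [← hd, map_smul, map_sub, map_smul, map_smul]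
    module
  have hinner := congrArg (fun y => ⟪y, ratComb multiplier x⟫) hsum
  simp only [inner_add_left, real_inner_smul_left _ _ τ, real_inner_smul_left d] at hinner
  unfold energy
  nlinarith [mul_le_mul_of_nonneg_left hβ hτ]

lemma sq_le_energy {A : H →L[ℝ] H} (hpos : ∀ v : H, 0 ≤ ⟪A v, v⟫) {τ : ℝ} (hτ : 0 ≤ τ)
    (x : Fin 7 → H) : ‖x 6‖ ^ 2 + τ * ⟪A (x 6), x 6⟫ ≤ energy A τ x := by
  have hα := le_gramForm_gramAlpha (b := innerₗ H) (fun x => real_inner_self_nonneg) x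
  have hβ := le_gramForm_gramBeta (b := operatorForm A) hpos x
  simp only [innerₗ_apply_apply, operatorForm_apply, real_inner_self_eq_norm_sq] at hα hβ
  exact add_le_add hα (mul_le_mul_of_nonneg_left hβ hτ)

/-- The constant bounding the initial energy. -/
noncomputable def initialEnergyConst : ℝ := absSum gramAlpha + absSum gramBeta

lemma initialEnergyConst_nonneg : 0 ≤ initialEnergyConst := by
  unfold initialEnergyConst absSum
  positivity

lemma energy_le {A : H →L[ℝ] H} (hA : ∀ v w : H, ⟪A v, w⟫ = ⟪v, A w⟫)
    (hpos : ∀ v : H, 0 ≤ ⟪A v, v⟫) {τ : ℝ} (hτ : 0 < τ) {x : Fin 7 → H} {c : ℝ}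
    (hx : ∀ i, ‖x i‖ ≤ c) (hx' : ∀ i, Real.sqrt τ * Real.sqrt ⟪A (x i), x i⟫ ≤ c) :
    energy A τ x ≤ initialEnergyConst * c ^ 2 := by
  have hα := gramForm_le (innerₗ H) (fun x y => real_inner_comm y x)
    (fun x => real_inner_self_nonneg) gramAlpha (x := x) (c := c ^ 2) fun i => by
      rw [innerₗ_apply_apply, real_inner_self_eq_norm_sq]
      exact pow_le_pow_left₀ (norm_nonneg _) (hx i) 2
  have hβ := gramForm_le (operatorForm A) (fun x y => by simp [hA x y, real_inner_comm]) hpos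
    gramBeta (x := x) (c := c ^ 2 / τ) fun i => by
      have h := pow_le_pow_left₀ (by positivity) (hx' i) 2
      rw [mul_pow, Real.sq_sqrt hτ.le, Real.sq_sqrt (hpos _)] at h
      rw [operatorForm_apply, le_div_iff₀ hτ]
      linarith
  have hβ' := mul_le_mul_of_nonneg_left hβ hτ.le
  have hcancel : τ * (absSum gramBeta * (c ^ 2 / τ)) = absSum gramBeta * c ^ 2 := by
    field_simp
  unfold energy initialEnergyConst
  linarith

/-- Cauchy–Schwarz for the duality between the energy norm and its dual norm. -/
lemma abs_inner_le_dual {A B : H →L[ℝ] H} (hA : ∀ v w : H, ⟪A v, w⟫ = ⟪v, A w⟫)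
    (hpos : ∀ v : H, 0 ≤ ⟪A v, v⟫) (hAB : ∀ v : H, A (B v) = v) (x w : H) :
    |⟪x, w⟫| ≤ Real.sqrt ⟪B x, x⟫ * Real.sqrt ⟪A w, w⟫ := by
  have hBx : 0 ≤ ⟪B x, x⟫ := by
    have h := hpos (B x)
    rwa [hAB, real_inner_comm] at h
  rw [← Real.sqrt_mul hBx]
  refine Real.abs_le_sqrt ?_
  have hquad : ∀ s : ℝ, 0 ≤ ⟪A w, w⟫ * (s * s) + 2 * ⟪x, w⟫ * s + ⟪B x, x⟫ := by
    intro s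
    have h := hpos (B x + s • w)
    simp only [map_add, map_smul, hAB, inner_add_left, inner_add_right, real_inner_smul_left,
      real_inner_smul_right] at h
    have hwx : ⟪A w, B x⟫ = ⟪x, w⟫ := by rw [hA, hAB, real_inner_comm]
    rw [hwx, real_inner_comm] at h
    linarith
  have h := discrim_le_zero hquad
  unfold discrim at h
  nlinarith

lemma iteratedDeriv_inner {u : ℝ → H} {n : ℕ} (hu : ContDiff ℝ n u) (w : H) (t : ℝ) :
    iteratedDeriv n (fun s => ⟪u s, w⟫) t = ⟪iteratedDeriv n u t, w⟫ := by
  have h := (innerSL ℝ w).iteratedFDeriv_comp_left (x := t) hu.contDiffAt le_rfl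
  have h' : (fun s => ⟪u s, w⟫) = innerSL ℝ w ∘ u := by
    ext s
    simp [real_inner_comm]
  rw [h', iteratedDeriv_eq_iteratedFDeriv, h, iteratedDeriv_eq_iteratedFDeriv]
  simp [real_inner_comm]

/-- The local truncation error of the WSBDF7 method at `a` with step `τ`. -/
noncomputable def truncation (u : ℝ → H) (a τ : ℝ) : H :=
  ∑ i : Fin 8, alphaCoeff i • u (a + i * τ)
    - τ • ((3 : ℝ) • deriv u (a + 7 * τ) - (2 : ℝ) • deriv u (a + 6 * τ))

lemma abs_inner_truncation_le {u : ℝ → H} (hu : ContDiff ℝ 8 u) {a τ K : ℝ} (hτ : 0 ≤ τ) (w : H)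
    (hK : ∀ t ∈ Set.Icc a (a + 7 * τ), |⟪iteratedDeriv 8 u t, w⟫| ≤ K) :
    |⟪truncation u a τ, w⟫| ≤ 25000 * τ ^ 8 * K := by
  have hφ : ContDiff ℝ 8 (fun s => ⟪u s, w⟫) := hu.inner ℝ contDiff_const
  have hderiv : ∀ t, deriv (fun s => ⟪u s, w⟫) t = ⟪deriv u t, w⟫ := by
    intro t
    have h := iteratedDeriv_inner (n := 1) (hu.of_le (by norm_num)) w t
    simpa only [iteratedDeriv_one] using h
  have h := abs_truncation_le hφ hτ (a := a) (K := K) fun t ht => by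
    rw [iteratedDeriv_inner (n := 8) hu]
    exact hK t ht
  simpa only [truncation, inner_sub_left, sum_inner, real_inner_smul_left, hderiv] using h

lemma energy_growth {A B : H →L[ℝ] H} (hA : ∀ v w : H, ⟪A v, w⟫ = ⟪v, A w⟫)
    (hpos : ∀ v : H, 0 ≤ ⟪A v, v⟫) (hAB : ∀ v : H, A (B v) = v) {u : ℝ → H}
    (hu : ContDiff ℝ 8 u) {a τ M : ℝ} (hτ : 0 < τ)
    (hM : ∀ t ∈ Set.Icc a (a + 7 * τ),
      Real.sqrt ⟪B (iteratedDeriv 8 u t), iteratedDeriv 8 u t⟫ ≤ M) {x : Fin 8 → H}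
    (hx : ∑ i, alphaCoeff i • x i + (3 * τ) • A (x 7) - (2 * τ) • A (x 6) = truncation u a τ) :
    energy A τ (Fin.tail x) ≤ energy A τ (Fin.init x) + (10500000 * M) ^ 2 * τ ^ 15 := by
  set w := ratComb multiplier x with hw
  have hstep := energy_step hA hpos hτ.le hx
  have hd := abs_inner_truncation_le hu hτ.le (a := a) (K := M * Real.sqrt ⟪A w, w⟫) w
    fun t ht => (abs_inner_le_dual hA hpos hAB _ _).trans (by gcongr; exact hM t ht)
  have hsq := Real.sq_sqrt (hpos w)
  set q := Real.sqrt ⟪A w, w⟫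
  rw [← hw, ← hsq] at hstep
  have hle := (le_abs_self _).trans hd
  have hyoung : 840 * (25000 * τ ^ 8 * (M * q)) ≤ τ * q ^ 2 + (10500000 * M) ^ 2 * τ ^ 15 := by
    have h := mul_nonneg hτ.le (sq_nonneg (q - 10500000 * τ ^ 7 * M))
    nlinarith
  linarith

lemma add_le_of_sq_add_sq_le {p q X y z : ℝ} (hX : 0 ≤ X) (hy : 0 ≤ y) (hz : 0 ≤ z)
    (h : p ^ 2 + q ^ 2 ≤ X ^ 2 * (y ^ 2 + z ^ 2)) : p + q ≤ 2 * X * (y + z) := by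
  refine le_of_sq_le_sq ?_ (by positivity)
  nlinarith [sq_nonneg (p - q), mul_nonneg (sq_nonneg X) (mul_nonneg hy hz),
    mul_nonneg (sq_nonneg X) (sq_nonneg y), mul_nonneg (sq_nonneg X) (sq_nonneg z)]

end ErrorEstimate

section MainEstimate

variable {H : Type*} [NormedAddCommGroup H] [InnerProductSpace ℝ H]

lemma error_equation {A : H →L[ℝ] H} {T τ : ℝ} {u f : ℝ → H}
    (hpde : ∀ t ∈ Set.Icc (0 : ℝ) T, deriv u t + A (u t) = f t) {v : ℕ → H} {n : ℕ}
    (hτ : 0 ≤ τ) (hT : ((n + 7 : ℕ) : ℝ) * τ ≤ T)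
    (hv : ∑ i : Fin 8, alphaCoeff i • v (n + i.1)
        + (3 * τ) • A (v (n + 7)) - (2 * τ) • A (v (n + 6))
      = (3 * τ) • f (((n + 7 : ℕ) : ℝ) * τ) - (2 * τ) • f (((n + 6 : ℕ) : ℝ) * τ)) :
    ∑ i : Fin 8, alphaCoeff i • (u (((n + i.1 : ℕ) : ℝ) * τ) - v (n + i.1))
        + (3 * τ) • A (u (((n + 7 : ℕ) : ℝ) * τ) - v (n + 7))
        - (2 * τ) • A (u (((n + 6 : ℕ) : ℝ) * τ) - v (n + 6))
      = truncation u (n * τ) τ := by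
  have h7 := hpde (((n + 7 : ℕ) : ℝ) * τ) ⟨by positivity, hT⟩
  have h6 := hpde (((n + 6 : ℕ) : ℝ) * τ)
    ⟨by positivity, le_trans (by gcongr; norm_num) hT⟩
  rw [← h7, ← h6] at hv
  have hnode : ∀ i : ℕ, (n : ℝ) * τ + i * τ = ((n + i : ℕ) : ℝ) * τ := fun i => by
    push_cast
    ring
  have hnode7 := hnode 7
  have hnode6 := hnode 6
  rw [Nat.cast_ofNat] at hnode7 hnode6
  simp only [truncation, hnode, hnode7, hnode6, smul_sub, Finset.sum_sub_distrib, map_sub]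
  rw [add_sub_assoc, ← eq_sub_iff_add_eq] at hv
  rw [hv]
  module

lemma energy_error_le {A B : H →L[ℝ] H} (hA : ∀ v w : H, ⟪A v, w⟫ = ⟪v, A w⟫)
    (hpos : ∀ v : H, 0 ≤ ⟪A v, v⟫) (hAB : ∀ v : H, A (B v) = v) {u f : ℝ → H}
    (hu : ContDiff ℝ 8 u) {T τ M c : ℝ} {N : ℕ} (hτ : 0 < τ) (hT : N * τ = T)
    (hpde : ∀ t ∈ Set.Icc (0 : ℝ) T, deriv u t + A (u t) = f t)
    (hM : ∀ t ∈ Set.Icc (0 : ℝ) T,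
      Real.sqrt ⟪B (iteratedDeriv 8 u t), iteratedDeriv 8 u t⟫ ≤ M) {v : ℕ → H}
    (hstart : ∀ i : ℕ, i ≤ 6 → ‖u ((i : ℝ) * τ) - v i‖ + Real.sqrt τ *
      Real.sqrt ⟪A (u ((i : ℝ) * τ) - v i), u ((i : ℝ) * τ) - v i⟫ ≤ c)
    (hv : ∀ n : ℕ, n + 7 ≤ N → ∑ i : Fin 8, alphaCoeff i • v (n + i.1)
        + (3 * τ) • A (v (n + 7)) - (2 * τ) • A (v (n + 6))
      = (3 * τ) • f (((n + 7 : ℕ) : ℝ) * τ) - (2 * τ) • f (((n + 6 : ℕ) : ℝ) * τ))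
    (n : ℕ) (hn : n + 6 ≤ N) :
    energy A τ (fun i : Fin 7 => u (((n + i.1 : ℕ) : ℝ) * τ) - v (n + i.1)) ≤
      initialEnergyConst * c ^ 2 + n * ((10500000 * M) ^ 2 * τ ^ 15) := by
  induction n with
  | zero =>
    have h := energy_le hA hpos hτ (c := c)
      (x := fun i : Fin 7 => u (((0 + i.1 : ℕ) : ℝ) * τ) - v (0 + i.1))
      (fun i => by
        rw [zero_add]
        exact (le_add_of_nonneg_right (by positivity)).trans (hstart i.1 (by omega)))
      (fun i => by
        simp only [zero_add]
        exact (le_add_of_nonneg_left (norm_nonneg _)).trans (hstart i.1 (by omega)))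
    simpa using h
  | succ n ih =>
    have hnT : ((n + 7 : ℕ) : ℝ) * τ ≤ T := by
      rw [← hT]
      gcongr
    have h := energy_growth hA hpos hAB hu hτ (a := n * τ) (M := M)
      (x := fun i : Fin 8 => u (((n + i.1 : ℕ) : ℝ) * τ) - v (n + i.1))
      (fun t ht => hM t ⟨le_trans (by positivity) ht.1, ht.2.trans (by
        push_cast at hnT
        linarith)⟩)
      (error_equation hpde hτ.le hnT (hv n (by omega)))
    have htail : Fin.tail (fun i : Fin 8 => u (((n + i.1 : ℕ) : ℝ) * τ) - v (n + i.1)) =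
        fun i : Fin 7 => u (((n + 1 + i.1 : ℕ) : ℝ) * τ) - v (n + 1 + i.1) := by
      ext i
      simp only [Fin.tail, Fin.val_succ, add_assoc, add_comm 1]
    have hinit : Fin.init (fun i : Fin 8 => u (((n + i.1 : ℕ) : ℝ) * τ) - v (n + i.1)) =
        fun i : Fin 7 => u (((n + i.1 : ℕ) : ℝ) * τ) - v (n + i.1) := rfl
    rw [htail, hinit] at h
    have ih' := ih (by omega)
    push_cast at h ih' ⊢
    linarith

lemma sqrt_dual_le_sSup {B : H →L[ℝ] H} {u : ℝ → H} (hu : ContDiff ℝ 8 u) {T t : ℝ}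
    (ht : t ∈ Set.Icc (0 : ℝ) T) :
    Real.sqrt ⟪B (iteratedDeriv 8 u t), iteratedDeriv 8 u t⟫ ≤
      sSup ((fun t => Real.sqrt ⟪B (iteratedDeriv 8 u t), iteratedDeriv 8 u t⟫) ''
        Set.Icc (0 : ℝ) T) := by
  have hc : Continuous (iteratedDeriv 8 u) := hu.continuous_iteratedDeriv 8 le_rfl
  have hc' : Continuous fun t => Real.sqrt ⟪B (iteratedDeriv 8 u t), iteratedDeriv 8 u t⟫ :=
    ((B.continuous.comp hc).inner hc).sqrt
  exact le_csSup (isCompact_Icc.image hc').bddAbove (Set.mem_image_of_mem _ ht)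

end MainEstimate

/-- Optimal-order error estimate of order 7 for the WSBDF7 method with θ = 3:
with `τ = T/N`, `t_n = nτ`, `‖v‖ = √(Av,v)`, `‖v‖_⋆ = √(A⁻¹v,v)`, and
`M = sup_{[0,T]} ‖u⁽⁸⁾‖_⋆`, if the starting values are `O(τ⁷)` accurate then
`|u(t_n) − uⁿ| + τ^{1/2}‖u(t_n) − uⁿ‖ ≤ C (C₀ + T^{1/2} M) τ⁷`. -/
theorem wsbdf7_error_estimate :
    ∃ C : ℝ, 0 < C ∧
      ∀ (H : Type) [_i1 : NormedAddCommGroup H] [_i2 : InnerProductSpace ℝ H]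
        [_i3 : CompleteSpace H]
        (A B : H →L[ℝ] H),
        (∀ v w : H, ⟪A v, w⟫ = ⟪v, A w⟫) →
        (∃ lam : ℝ, 0 < lam ∧ ∀ v : H, lam * ‖v‖ ^ 2 ≤ ⟪A v, v⟫) →
        (∀ v : H, A (B v) = v) → (∀ v : H, B (A v) = v) →
        ∀ T : ℝ, 0 < T → ∀ N : ℕ, 7 ≤ N →
        ∀ u : ℝ → H, ContDiff ℝ 8 u →
        ∀ f : ℝ → H,
          (∀ t ∈ Set.Icc (0 : ℝ) T, deriv u t + A (u t) = f t) →
          ∀ C₀ : ℝ, 0 ≤ C₀ →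
          ∀ v : ℕ → H,
            (∀ i : ℕ, i ≤ 6 →
              ‖u ((i : ℝ) * (T / N)) - v i‖
                + Real.sqrt (T / N) *
                  Real.sqrt ⟪A (u ((i : ℝ) * (T / N)) - v i),
                             u ((i : ℝ) * (T / N)) - v i⟫
                ≤ C₀ * (T / N) ^ 7) →
            (∀ n : ℕ, n ≤ N - 7 →
              ∑ i : Fin 8, alphaCoeff i • v (n + i.1)
                  + (3 * (T / N)) • A (v (n + 7)) - (2 * (T / N)) • A (v (n + 6))
                = (3 * (T / N)) • f (((n + 7 : ℕ) : ℝ) * (T / N))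
                  - (2 * (T / N)) • f (((n + 6 : ℕ) : ℝ) * (T / N))) →
            ∀ n : ℕ, n ≤ N →
              ‖u ((n : ℝ) * (T / N)) - v n‖
                + Real.sqrt (T / N) *
                  Real.sqrt ⟪A (u ((n : ℝ) * (T / N)) - v n),
                             u ((n : ℝ) * (T / N)) - v n⟫
                ≤ C * (C₀ + Real.sqrt T *
                    sSup ((fun t => Real.sqrt ⟪B (iteratedDeriv 8 u t),
                        iteratedDeriv 8 u t⟫) '' Set.Icc (0 : ℝ) T))
                  * (T / N) ^ 7 := by

  have hX := initialEnergyConst_nonneg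
  set X := initialEnergyConst + 10500000 with hXdef
  refine ⟨2 * X, by positivity, ?_⟩
  intro H _ _ _ A B hA hcoer hAB _ T hT N hN u hu f hpde C₀ hC₀ v hstart hv n hn
  have hpos : ∀ w : H, 0 ≤ ⟪A w, w⟫ := by
    obtain ⟨lam, hlam, h⟩ := hcoer
    exact fun w => le_trans (by positivity) (h w)
  have hN0 : (0 : ℝ) < N := by exact_mod_cast (by omega : 0 < N)
  have hNT : N * (T / N) = T := by field_simp
  have hτ : 0 < T / N := by positivity
  have hM := fun t (ht : t ∈ Set.Icc (0 : ℝ) T) => sqrt_dual_le_sSup (B := B) hu ht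
  set M := sSup ((fun t => Real.sqrt ⟪B (iteratedDeriv 8 u t), iteratedDeriv 8 u t⟫) ''
    Set.Icc (0 : ℝ) T)
  have hM0 : 0 ≤ M := (Real.sqrt_nonneg _).trans (hM 0 ⟨le_rfl, hT.le⟩)
  set τ := T / N
  have hy : 0 ≤ C₀ * τ ^ 7 := by positivity
  have hz : 0 ≤ Real.sqrt T * M * τ ^ 7 := by positivity
  have hgoal : 2 * X * (C₀ + Real.sqrt T * M) * τ ^ 7 =
      2 * X * (C₀ * τ ^ 7 + Real.sqrt T * M * τ ^ 7) := by ring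
  rw [hgoal]
  rcases le_or_gt n 6 with h6 | h6
  · refine (hstart n h6).trans ?_
    nlinarith
  obtain ⟨k, rfl⟩ : ∃ k, n = k + 6 := ⟨n - 6, by omega⟩
  have hE := energy_error_le hA hpos hAB hu hτ hNT hpde hM hstart
    (fun m hm => hv m (by omega)) k hn
  have hlow := sq_le_energy hpos hτ.le
    (fun i : Fin 7 => u (((k + i.1 : ℕ) : ℝ) * τ) - v (k + i.1))
  refine add_le_of_sq_add_sq_le (by positivity) hy hz ?_
  rw [mul_pow, Real.sq_sqrt hτ.le, Real.sq_sqrt (hpos _)]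
  refine (hlow.trans hE).trans ?_
  have hkT : k * τ ≤ T := by
    rw [← hNT]
    gcongr
    omega
  have hsource : k * ((10500000 * M) ^ 2 * τ ^ 15) ≤
      10500000 ^ 2 * (Real.sqrt T * M * τ ^ 7) ^ 2 := by
    calc k * ((10500000 * M) ^ 2 * τ ^ 15) = k * τ * (10500000 ^ 2 * (M * τ ^ 7) ^ 2) := by ring
      _ ≤ T * (10500000 ^ 2 * (M * τ ^ 7) ^ 2) := by gcongr
      _ = 10500000 ^ 2 * (Real.sqrt T ^ 2 * (M * τ ^ 7) ^ 2) := by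
        rw [Real.sq_sqrt hT.le]
        ring
      _ = _ := by ring
  rw [mul_add]
  refine add_le_add ?_ (hsource.trans ?_)
  · gcongr
    nlinarith
  · gcongr
    linarith
end
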